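/- Let q > 1, 0 < α ≤ 1, and a(k) = ∏_{m=0}^{k-1} (q^{-mα-1} - 1). Then for every real t ≥ 0 the series ∑_{k=0}^∞ a(k) · t^{kα} / Γ(kα + 1) is absolutely convergent, i.e. the family k ↦ |a(k)| t^{kα}/Γ(kα+1) is summable. -/

import Mathlib

open MeasureTheory Set in
/-- Integrating over `(A, ∞)` only bounds the Gamma function below by exponentials of any base. -/
theorem rpow_mul_exp_neg_le_Gamma_add_one {A s : ℝ} (hA : 0 ≤ A) (hs : 0 ≤ s) :
    A ^ s * Real.exp (-A) ≤ Real.Gamma (s + 1) := by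
  have hint : IntegrableOn (fun x : ℝ => Real.exp (-x) * x ^ s) (Ioi 0) := by
    simpa using Real.GammaIntegral_convergent (s := s + 1) (by linarith)
  calc A ^ s * Real.exp (-A) = ∫ x in Ioi A, A ^ s * Real.exp (-x) := by
        rw [integral_const_mul, integral_exp_neg_Ioi]
    _ ≤ ∫ x in Ioi A, Real.exp (-x) * x ^ s := by
        refine setIntegral_mono_on ((integrableOn_exp_neg_Ioi A).const_mul _)
          (hint.mono_set (Ioi_subset_Ioi hA)) measurableSet_Ioi fun x hx => ?_
        rw [mul_comm]
        gcongr
        exact le_of_lt hx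
    _ ≤ ∫ x in Ioi 0, Real.exp (-x) * x ^ s := by
        refine setIntegral_mono_set hint ?_ (Ioi_subset_Ioi hA).eventuallyLE
        filter_upwards [ae_restrict_mem measurableSet_Ioi] with x hx
        have : 0 < x := hx
        show 0 ≤ _
        positivity
    _ = Real.Gamma (s + 1) := by
        rw [Real.Gamma_eq_integral (by linarith)]
        simp

/-- The Mittag-Leffler series converges. -/
theorem summable_rpow_div_Gamma {α t : ℝ} (hα : 0 < α) (ht : 0 ≤ t) :
    Summable (fun k : ℕ => t ^ ((k : ℝ) * α) / Real.Gamma ((k : ℝ) * α + 1)) := by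
  have hr : (t / (t + 1)) ^ α < 1 :=
    Real.rpow_lt_one (by positivity) (by rw [div_lt_one] <;> linarith) hα
  refine Summable.of_nonneg_of_le
    (fun k => div_nonneg (by positivity) (Real.Gamma_pos_of_pos (by positivity)).le) (fun k => ?_)
    ((summable_geometric_of_lt_one (by positivity) hr).mul_left (Real.exp (t + 1)))
  calc t ^ ((k : ℝ) * α) / Real.Gamma ((k : ℝ) * α + 1)
      ≤ t ^ ((k : ℝ) * α) / ((t + 1) ^ ((k : ℝ) * α) * Real.exp (-(t + 1))) := by
        gcongr
        exact rpow_mul_exp_neg_le_Gamma_add_one (by positivity) (by positivity)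
    _ = Real.exp (t + 1) * ((t / (t + 1)) ^ α) ^ k := by
        rw [← Real.rpow_mul_natCast (by positivity), mul_comm α,
          Real.div_rpow ht (by positivity), Real.exp_neg]
        field_simp

theorem abs_prod_rpow_sub_one_le_one {q α : ℝ} (hq : 1 < q) (hα : 0 < α) (k : ℕ) :
    |∏ m ∈ Finset.range k, (q ^ (-(m : ℝ) * α - 1) - 1)| ≤ 1 := by
  rw [Finset.abs_prod]
  refine Finset.prod_le_one (fun _ _ => abs_nonneg _) fun m _ => ?_
  have h0 : 0 < q ^ (-(m : ℝ) * α - 1) := by positivity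
  have h1 : q ^ (-(m : ℝ) * α - 1) ≤ 1 :=
    Real.rpow_le_one_of_one_le_of_nonpos hq.le (by nlinarith [m.cast_nonneg (α := ℝ)])
  rw [abs_le]
  constructor <;> linarith

/-- For `q > 1`, `0 < α ≤ 1`, the series
`∑_k a k * t^(kα) / Γ(kα+1)` with `a k = ∏_{m=0}^{k-1} (q^{-mα-1} - 1)` is
absolutely convergent for every real `t ≥ 0`. -/
theorem ambartsumian_series_abs_summable (q α : ℝ) (hq : 1 < q) (hα0 : 0 < α) (hα1 : α ≤ 1)
    (t : ℝ) (ht : 0 ≤ t) :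
    Summable (fun k : ℕ =>
      |∏ m ∈ Finset.range k, (q ^ (-(m : ℝ) * α - 1) - 1)| *
        t ^ ((k : ℝ) * α) / Real.Gamma ((k : ℝ) * α + 1)) := by
  have hΓ (k : ℕ) : 0 < Real.Gamma ((k : ℝ) * α + 1) := Real.Gamma_pos_of_pos (by positivity)
  refine Summable.of_nonneg_of_le
    (fun k => div_nonneg (by positivity) (hΓ k).le) (fun k => ?_) (summable_rpow_div_Gamma hα0 ht)
  have := (hΓ k).le
  gcongr
  exact mul_le_of_le_one_left (by positivity) (abs_prod_rpow_sub_one_le_one hq hα0 k)
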